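/- Let d, n, M ∈ ℕ, let Ω = {x_1,…,x_M} ⊂ S^{d−1} be q-separated, i.e., min_{j≠ℓ} arccos(x_jᵀ x_ℓ) > q, and assume n > 2.5π d / q + 1. Let N denote the dimension of the space of restrictions to S^{d−1} of real polynomials of total degree at most n. Then there exist real polynomials p_1,…,p_M of total degree at most n such that the function p : S^{d−1} → ℝ defined by p(x) = (2π^{d/2} / (Γ(d/2) N)) Σ_{r=1}^M p_r(x)² is the restriction to S^{d−1} of a polynomial of degree at most 2n and satisfies 0 ≤ p(x) ≤ 1 for all x ∈ S^{d−1}, with p(x) = 1 if and only if x ∈ Ω. -/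

import Mathlib

/-- The space of restrictions to the unit sphere `S^{d-1} = {x ∈ ℝ^d : ∑ x_i² = 1}` of
real polynomials of total degree at most `n`, i.e. `Π_n / I_n(S^{d-1})` realized as a
subspace of functions on the sphere. -/
noncomputable def spherePolySpace (d n : ℕ) :
    Submodule ℝ (({x : Fin d → ℝ // ∑ i, x i ^ 2 = 1}) → ℝ) :=
  (MvPolynomial.restrictTotalDegree (Fin d) ℝ n).map
    (LinearMap.pi fun x => (MvPolynomial.aeval (R := ℝ) x.1).toLinearMap)

/-- The normalization constant `2 π^{d/2} / (Γ(d/2) N)` of the dual certificate, where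
`2 π^{d/2} / Γ(d/2)` is the surface area of `S^{d-1}`. -/
noncomputable def certConst (d N : ℕ) : ℝ :=
  2 * Real.pi ^ ((d : ℝ) / 2) / (Real.Gamma ((d : ℝ) / 2) * N)

open Finset in
lemma card_le_of_pairwise_separated {ι E : Type*} [NormedAddCommGroup E] [NormedSpace ℝ E]
    [FiniteDimensional ℝ E] (s : Finset ι) (v : ι → E) {δ R : ℝ} (hδ : 0 < δ) (hR : 0 ≤ R)
    (hs : ∀ a ∈ s, ‖v a‖ ≤ R) (h : ∀ a ∈ s, ∀ b ∈ s, a ≠ b → δ ≤ ‖v a - v b‖) :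
    (s.card : ℝ) ≤ ((2 * R + δ) / δ) ^ Module.finrank ℝ E := by
  borelize E
  let μ : MeasureTheory.Measure E := MeasureTheory.Measure.addHaar
  have hρ : 0 < R + δ / 2 := by positivity
  have hdisj : Set.Pairwise (s : Set ι)
      (Function.onFun Disjoint fun a => Metric.ball (v a) (δ / 2)) := by
    intro a ha b hb hab
    apply Metric.ball_disjoint_ball
    rw [dist_eq_norm, add_halves]
    exact h a ha b hb hab
  have hsub : (⋃ a ∈ s, Metric.ball (v a) (δ / 2)) ⊆ Metric.ball (0 : E) (R + δ / 2) := by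
    refine Set.iUnion₂_subset fun a ha => Metric.ball_subset_ball' ?_
    rw [dist_zero_right]
    linarith [hs a ha]
  have hvol : (s.card : ENNReal) * ENNReal.ofReal ((δ / 2) ^ Module.finrank ℝ E)
        * μ (Metric.ball 0 1) ≤
      ENNReal.ofReal ((R + δ / 2) ^ Module.finrank ℝ E) * μ (Metric.ball 0 1) :=
    calc
      _ = μ (⋃ a ∈ s, Metric.ball (v a) (δ / 2)) := by
        rw [MeasureTheory.measure_biUnion_finset hdisj fun _ _ => measurableSet_ball]
        simp only [μ.addHaar_ball_of_pos _ (half_pos hδ), sum_const, nsmul_eq_mul, mul_assoc]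
      _ ≤ μ (Metric.ball (0 : E) (R + δ / 2)) := MeasureTheory.measure_mono hsub
      _ = _ := μ.addHaar_ball_of_pos _ hρ
  have hle := (ENNReal.mul_le_mul_iff_left
    (Metric.measure_ball_pos μ _ zero_lt_one).ne' MeasureTheory.measure_ball_lt_top.ne).1 hvol
  have hreal := ENNReal.toReal_le_of_le_ofReal (pow_nonneg hρ.le _) hle
  rw [ENNReal.toReal_mul, ENNReal.toReal_natCast, ENNReal.toReal_ofReal (by positivity)] at hreal
  rw [show (2 * R + δ) / δ = (R + δ / 2) / (δ / 2) by field_simp, div_pow,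
    le_div_iff₀ (by positivity)]
  exact hreal

lemma sum_Icc_shell_le (B : ℕ) :
    ∑ k ∈ Finset.Icc 1 (B + 1), (0.16 * (2 * (k : ℝ) + 3) / (k : ℝ) ^ 2) ^ 2
      ≤ 0.9536 - 0.3136 / ((B : ℝ) + 1) := by
  induction B with
  | zero => norm_num
  | succ B ih =>
    rw [Finset.sum_Icc_succ_top (by omega)]
    have hB : (0 : ℝ) ≤ B := Nat.cast_nonneg B
    have hstep : (0.16 * (2 * ((B + 1 + 1 : ℕ) : ℝ) + 3) / ((B + 1 + 1 : ℕ) : ℝ) ^ 2) ^ 2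
        ≤ 0.3136 / ((B : ℝ) + 1) - 0.3136 / ((B : ℝ) + 1 + 1) := by
      push_cast
      set b : ℝ := (B : ℝ) + 1 + 1 with hb
      have hb2 : 2 ≤ b := by linarith
      have h1 : 0.16 * (2 * b + 3) / b ^ 2 ≤ 0.56 / b := by
        rw [div_le_div_iff₀ (by positivity) (by positivity)]
        nlinarith
      have h2 : (0.16 * (2 * b + 3) / b ^ 2) ^ 2 ≤ (0.56 / b) ^ 2 := by
        gcongr
      refine h2.trans ?_
      rw [show (B : ℝ) + 1 = b - 1 by rw [hb]; ring, div_pow,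
        div_sub_div _ _ (by linarith) (by linarith),
        div_le_div_iff₀ (by positivity) (by nlinarith)]
      nlinarith
    push_cast at hstep ⊢
    linarith

lemma sum_inv_norm_pow_lt_one {ι E : Type*} [NormedAddCommGroup E] [NormedSpace ℝ E]
    [FiniteDimensional ℝ E] (hdim : 2 ≤ Module.finrank ℝ E) (s : Finset ι) (v : ι → E)
    {δ A : ℝ} (hδ : 0 < δ) (hA : 0 ≤ A) (hAδ : A ≤ 0.16 * δ ^ 2)
    (hs : ∀ a ∈ s, δ ≤ ‖v a‖) (h : ∀ a ∈ s, ∀ b ∈ s, a ≠ b → δ ≤ ‖v a - v b‖) :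
    ∑ a ∈ s, (A / ‖v a‖ ^ 2) ^ Module.finrank ℝ E < 1 := by
  set D := Module.finrank ℝ E
  let f : ι → ℕ := fun a => ⌊‖v a‖ / δ⌋₊
  have hf1 : ∀ a ∈ s, 1 ≤ f a := fun a ha =>
    Nat.le_floor (by rw [Nat.cast_one, le_div_iff₀ hδ, one_mul]; exact hs a ha)
  have hmaps : ∀ a ∈ s, f a ∈ Finset.Icc 1 (s.sup f + 1) := fun a ha =>
    Finset.mem_Icc.2 ⟨hf1 a ha, (Finset.le_sup ha).trans (Nat.le_succ _)⟩
  rw [← Finset.sum_fiberwise_of_maps_to hmaps]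
  have hshell : ∀ k ∈ Finset.Icc 1 (s.sup f + 1),
      ∑ a ∈ s with f a = k, (A / ‖v a‖ ^ 2) ^ D
        ≤ (0.16 * (2 * (k : ℝ) + 3) / (k : ℝ) ^ 2) ^ 2 := by
    intro k hk
    have hk1 : 1 ≤ k := (Finset.mem_Icc.1 hk).1
    have hk1' : (1 : ℝ) ≤ k := by exact_mod_cast hk1
    have hcard := card_le_of_pairwise_separated (s.filter fun a => f a = k) v hδ
      (R := ((k : ℝ) + 1) * δ) (by positivity)
      (fun a ha => by
        have h1 := (Nat.lt_floor_add_one (‖v a‖ / δ)).le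
        rw [div_le_iff₀ hδ] at h1
        rw [← (Finset.mem_filter.1 ha).2]
        exact h1)
      (fun a ha b hb => h a (Finset.mem_filter.1 ha).1 b (Finset.mem_filter.1 hb).1)
    rw [show (2 * (((k : ℝ) + 1) * δ) + δ) / δ = 2 * k + 3 by field_simp; ring] at hcard
    have hterm : ∀ a ∈ s.filter (fun a => f a = k),
        (A / ‖v a‖ ^ 2) ^ D ≤ (0.16 / (k : ℝ) ^ 2) ^ D := by
      intro a ha
      have h1 : (k : ℝ) ≤ ‖v a‖ / δ := by
        rw [← (Finset.mem_filter.1 ha).2]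
        exact Nat.floor_le (by positivity)
      rw [le_div_iff₀ hδ] at h1
      have h2 : ((k : ℝ) * δ) ^ 2 ≤ ‖v a‖ ^ 2 := by gcongr
      have h3 : 0 < ((k : ℝ) * δ) ^ 2 := by positivity
      refine pow_le_pow_left₀ (by positivity) ?_ _
      rw [div_le_div_iff₀ (by linarith) (by positivity)]
      nlinarith [sq_nonneg (k : ℝ)]
    calc ∑ a ∈ s with f a = k, (A / ‖v a‖ ^ 2) ^ D
        ≤ (s.filter fun a => f a = k).card * (0.16 / (k : ℝ) ^ 2) ^ D := by
          rw [← nsmul_eq_mul]; exact Finset.sum_le_card_nsmul _ _ _ hterm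
      _ ≤ (2 * (k : ℝ) + 3) ^ D * (0.16 / (k : ℝ) ^ 2) ^ D := by gcongr
      _ = (0.16 * (2 * (k : ℝ) + 3) / (k : ℝ) ^ 2) ^ D := by rw [← mul_pow]; congr 1; ring
      _ ≤ _ := by
          refine pow_le_pow_of_le_one (by positivity) ?_ hdim
          rw [div_le_one (by positivity)]
          nlinarith
  have := (Finset.sum_le_sum hshell).trans (sum_Icc_shell_le (s.sup f))
  have hpos : 0 < 0.3136 / (((s.sup f : ℕ) : ℝ) + 1) := by positivity
  linarith

open Polynomial in
lemma exists_localized_polynomial {L : ℕ} (hL : 0 < L) :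
    ∃ Q : ℝ[X], Q.natDegree ≤ L - 1 ∧ Q.eval 1 = 1 ∧
      ∀ t : ℝ, |t| ≤ 1 → t ≠ 1 → |Q.eval t| ≤ 2 / ((L : ℝ) ^ 2 * (1 - t)) := by
  have hroot : (Chebyshev.T ℝ L - 1).IsRoot 1 := by simp
  obtain ⟨Q, hQ⟩ := dvd_iff_isRoot.2 hroot
  have hQ1 : Q.eval 1 = (L : ℝ) ^ 2 := by
    have h := congrArg (fun p => (derivative p).eval 1) hQ
    simp [Chebyshev.T_derivative_eq_U] at h
    rw [← h]; ring
  have hdeg : (X - C 1 : ℝ[X]).natDegree + Q.natDegree ≤ L := by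
    have hQ0 : Q ≠ 0 := by
      rintro rfl
      exact (show (0 : ℝ) < (L : ℝ) ^ 2 by positivity).ne (by rwa [eval_zero] at hQ1)
    rw [← natDegree_mul (X_sub_C_ne_zero 1) hQ0, ← hQ]
    refine (natDegree_sub_le _ _).trans ?_
    simp [Chebyshev.natDegree_T]
  rw [natDegree_X_sub_C] at hdeg
  refine ⟨C ((L : ℝ) ^ 2)⁻¹ * Q, (natDegree_C_mul_le _ _).trans (by omega), ?_, ?_⟩
  · rw [eval_mul, eval_C, hQ1, inv_mul_cancel₀ (by positivity)]
  · intro t ht ht1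
    have hlt : 0 < 1 - t := by
      have := (abs_le.1 ht).2
      have := lt_of_le_of_ne this ht1
      linarith
    have h := congrArg (eval t) hQ
    simp only [eval_sub, eval_mul, eval_X, eval_C, eval_one] at h
    have hT := Chebyshev.abs_eval_T_real_le_one L ht
    rw [eval_mul, eval_C, abs_mul, abs_of_nonneg (by positivity), inv_mul_eq_div,
      div_le_div_iff₀ (by positivity) (by positivity)]
    have h2 : |Q.eval t| * (1 - t) ≤ 2 := by
      rw [← abs_of_pos hlt, ← abs_mul, show Q.eval t * (1 - t) = 1 - eval t (Chebyshev.T ℝ L) by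
        linarith]
      have := abs_le.1 hT
      rw [abs_le]; constructor <;> linarith
    nlinarith [sq_nonneg (L : ℝ)]

open MvPolynomial in
lemma totalDegree_polynomial_aeval_le {σ : Type*} (p : MvPolynomial σ ℝ) (hp : p.totalDegree ≤ 1)
    (K : Polynomial ℝ) : (Polynomial.aeval p K).totalDegree ≤ K.natDegree := by
  rw [Polynomial.aeval_eq_sum_range]
  refine totalDegree_finsetSum_le fun i hi => ?_
  have hi' : i ≤ K.natDegree := Nat.lt_succ_iff.1 (Finset.mem_range.1 hi)
  refine (totalDegree_smul_le _ _).trans ((totalDegree_pow _ _).trans ?_)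
  exact (Nat.mul_le_mul hi' hp).trans (mul_one _).le

open MvPolynomial in
lemma eval_polynomial_aeval {σ : Type*} (p : MvPolynomial σ ℝ) (K : Polynomial ℝ) (y : σ → ℝ) :
    eval y (Polynomial.aeval p K) = K.eval (eval y p) := by
  simp [Polynomial.aeval_eq_sum_range, Polynomial.eval_eq_sum_range, smul_eval]

lemma norm_sub_sq_of_sphere {d : ℕ} {a b : Fin d → ℝ} (ha : ∑ i, a i ^ 2 = 1)
    (hb : ∑ i, b i ^ 2 = 1) :
    ‖(WithLp.toLp 2 a : EuclideanSpace ℝ (Fin d)) - WithLp.toLp 2 b‖ ^ 2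
      = 2 * (1 - ∑ i, a i * b i) := by
  rw [EuclideanSpace.norm_sq_eq]
  have : ∀ i, ‖(WithLp.toLp 2 a - WithLp.toLp 2 b : EuclideanSpace ℝ (Fin d)) i‖ ^ 2
      = a i ^ 2 + b i ^ 2 - 2 * (a i * b i) := fun i => by
    simp; ring
  simp only [this, Finset.sum_sub_distrib, Finset.sum_add_distrib, ha, hb, ← Finset.mul_sum]
  ring

lemma abs_sum_mul_le_one {d : ℕ} {a b : Fin d → ℝ} (ha : ∑ i, a i ^ 2 = 1)
    (hb : ∑ i, b i ^ 2 = 1) : |∑ i, a i * b i| ≤ 1 := by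
  rw [← sq_le_one_iff_abs_le_one]
  simpa [ha, hb] using Finset.sum_mul_sq_le_sq_mul_sq Finset.univ a b

lemma two_div_pi_mul_le_norm_sub {d : ℕ} {a b : Fin d → ℝ} (ha : ∑ i, a i ^ 2 = 1)
    (hb : ∑ i, b i ^ 2 = 1) :
    2 / Real.pi * Real.arccos (∑ i, a i * b i)
      ≤ ‖(WithLp.toLp 2 a : EuclideanSpace ℝ (Fin d)) - WithLp.toLp 2 b‖ := by
  have ht := abs_le.1 (abs_sum_mul_le_one ha hb)
  set t := ∑ i, a i * b i with ht_def
  have h0 := Real.arccos_nonneg t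
  have hsin := Real.mul_le_sin (x := Real.arccos t / 2) (by linarith)
    (by linarith [Real.arccos_le_pi t])
  have hpi := Real.pi_pos
  have hsq : (2 * Real.sin (Real.arccos t / 2)) ^ 2 = 2 * (1 - t) := by
    have h := Real.cos_sq (Real.arccos t / 2)
    rw [mul_div_cancel₀ _ two_ne_zero, Real.cos_arccos ht.1 ht.2] at h
    have h' := Real.sin_sq_add_cos_sq (Real.arccos t / 2)
    nlinarith
  have h1 : 2 / Real.pi * Real.arccos t ≤ 2 * Real.sin (Real.arccos t / 2) := by
    calc _ = 2 * (2 / Real.pi * (Real.arccos t / 2)) := by ring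
      _ ≤ _ := by linarith
  refine h1.trans (le_of_sq_le_sq ?_ (norm_nonneg _))
  rw [hsq, norm_sub_sq_of_sphere ha hb]

open MvPolynomial in
lemma exists_lagrange_of_kernel {d m M : ℕ} (x : Fin M → Fin d → ℝ)
    (hsph : ∀ j, ∑ i, x j i ^ 2 = 1) (K : Polynomial ℝ) (hdeg : K.natDegree ≤ m)
    (hK1 : K.eval 1 = 1)
    (hK : ∀ j, ∑ l ∈ Finset.univ.erase j, |K.eval (∑ i, x j i * x l i)| < 1) (j : Fin M) :
    ∃ f : MvPolynomial (Fin d) ℝ, f.totalDegree ≤ m ∧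
      ∀ l, eval (x l) f = if l = j then 1 else 0 := by
  let G : Matrix (Fin M) (Fin M) ℝ := fun a b => K.eval (∑ i, x a i * x b i)
  have hdet : G.det ≠ 0 := by
    refine det_ne_zero_of_sum_row_lt_diag fun k => ?_
    have hkk : G k k = 1 := by
      simp only [G, ← pow_two, hsph, hK1]
    rw [hkk, norm_one]
    exact hK k
  have hinv : G * G⁻¹ = 1 := Matrix.mul_nonsing_inv G (isUnit_iff_ne_zero.2 hdet)
  refine ⟨∑ b, C (G⁻¹ b j) * Polynomial.aeval (∑ i, C (x b i) * X i : MvPolynomial (Fin d) ℝ) K,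
    totalDegree_finsetSum_le fun b _ => ?_, fun l => ?_⟩
  · refine (totalDegree_mul _ _).trans ?_
    rw [totalDegree_C, zero_add]
    refine (totalDegree_polynomial_aeval_le _ (totalDegree_finsetSum_le fun i _ => ?_) K).trans hdeg
    refine (totalDegree_mul _ _).trans ?_
    rw [totalDegree_C, zero_add, totalDegree_X]
  · have h := congrFun (congrFun hinv l) j
    rw [Matrix.mul_apply, Matrix.one_apply] at h
    rw [← h, map_sum]
    refine Finset.sum_congr rfl fun b _ => ?_
    rw [map_mul, eval_C, eval_polynomial_aeval, mul_comm]
    simp [G, mul_comm]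

open MvPolynomial in
lemma exists_lagrange_of_separated {d m M : ℕ} (hd : 0 < d) (x : Fin M → Fin d → ℝ)
    (hsph : ∀ j, ∑ i, x j i ^ 2 = 1) {q : ℝ} (hq : 0 < q)
    (hsep : ∀ j l, j ≠ l → q < Real.arccos (∑ i, x j i * x l i))
    (hmq : 2.5 * Real.pi * d / q < m) (j : Fin M) :
    ∃ f : MvPolynomial (Fin d) ℝ, f.totalDegree ≤ m ∧
      ∀ l, eval (x l) f = if l = j then 1 else 0 := by
  have hpi := Real.pi_pos
  have hd' : (0 : ℝ) < d := by exact_mod_cast hd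
  have hm : 1 ≤ m := by
    have : (0 : ℝ) < m := lt_trans (by positivity) hmq
    exact_mod_cast this
  have hlt : ∀ a b, a ≠ b → ∑ i, x a i * x b i < 1 := fun a b hab => by
    have := hq.trans (hsep a b hab)
    exact Real.arccos_pos.1 this
  rcases (show d = 1 ∨ 2 ≤ d by omega) with rfl | hd2
  · refine exists_lagrange_of_kernel x hsph
      (Polynomial.C (1 / 2) * (Polynomial.X + Polynomial.C 1)) ?_ ?_ ?_ j
    · refine (Polynomial.natDegree_C_mul_le _ _).trans ?_
      rwa [Polynomial.natDegree_X_add_C]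
    · norm_num
    · intro a
      rw [Finset.sum_eq_zero]
      · norm_num
      · intro b hb
        have hab := hlt a b (Finset.ne_of_mem_erase hb).symm
        have ha := hsph a
        have hb := hsph b
        simp only [Fin.sum_univ_one, Fin.isValue] at ha hb hab ⊢
        have : x a 0 * x b 0 = -1 := by
          have h : (x a 0 * x b 0 - 1) * (x a 0 * x b 0 + 1) = 0 := by
            linear_combination x b 0 ^ 2 * ha + hb
          rcases mul_eq_zero.1 h with h | h <;> linarith
        simp [this]
  · set L := m / d + 1
    obtain ⟨Q, hQdeg, hQ1, hQ⟩ := exists_localized_polynomial (L := L) (Nat.succ_pos _)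
    refine exists_lagrange_of_kernel x hsph (Q ^ d) ?_ (by simp [hQ1]) ?_ j
    · refine Polynomial.natDegree_pow_le.trans ?_
      calc d * Q.natDegree ≤ d * (m / d) := Nat.mul_le_mul_left _ hQdeg
        _ ≤ m := Nat.mul_div_le m d
    · intro a
      have hLq : 2.5 * Real.pi / q < L := by
        have h1 : (m : ℝ) < d * L := by
          have := Nat.lt_mul_div_succ m hd
          exact_mod_cast this
        have h2 : 2.5 * Real.pi * d / q = d * (2.5 * Real.pi / q) := by ring
        rw [h2] at hmq
        exact lt_of_mul_lt_mul_left (hmq.trans h1) hd'.le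
      have hL0 : (0 : ℝ) < L := by positivity
      set δ := 2 / Real.pi * q with hδ
      have hδ0 : 0 < δ := by positivity
      have hdist : ∀ b c, b ≠ c →
          δ ≤ ‖(WithLp.toLp 2 (x b) : EuclideanSpace ℝ (Fin d)) - WithLp.toLp 2 (x c)‖ :=
        fun b c hbc => le_trans (by rw [hδ]; gcongr; exact (hsep b c hbc).le)
          (two_div_pi_mul_le_norm_sub (hsph b) (hsph c))
      have hAδ : 4 / (L : ℝ) ^ 2 ≤ 0.16 * δ ^ 2 := by
        have h5 : 5 ≤ δ * L := by
          calc (5 : ℝ) = δ * (2.5 * Real.pi / q) := by rw [hδ]; field_simp; norm_num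
            _ ≤ δ * L := by gcongr
        rw [div_le_iff₀ (by positivity)]
        nlinarith
      have hsum := sum_inv_norm_pow_lt_one (E := EuclideanSpace ℝ (Fin d)) (by simpa using hd2)
        (Finset.univ.erase a) (fun b => WithLp.toLp 2 (x a) - WithLp.toLp 2 (x b)) hδ0
        (by positivity) hAδ (fun b hb => hdist a b (Finset.ne_of_mem_erase hb).symm)
        (fun b _ c _ hbc => by
          rw [sub_sub_sub_cancel_left]
          exact hdist c b hbc.symm)
      refine lt_of_le_of_lt (Finset.sum_le_sum fun b hb => ?_) hsum
      have hab := hlt a b (Finset.ne_of_mem_erase hb).symm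
      rw [Polynomial.eval_pow, abs_pow, finrank_euclideanSpace_fin,
        norm_sub_sq_of_sphere (hsph a) (hsph b)]
      refine pow_le_pow_left₀ (abs_nonneg _)
        ((hQ _ (abs_sum_mul_le_one (hsph a) (hsph b)) hab.ne).trans_eq ?_) _
      have : 1 - ∑ i, x a i * x b i ≠ 0 := by linarith
      field_simp
      norm_num

open MvPolynomial in
lemma exists_vanishing_of_lagrange {d m M : ℕ} (x : Fin M → Fin d → ℝ)
    (hx : ∀ j, ∃ f : MvPolynomial (Fin d) ℝ, f.totalDegree ≤ m ∧
      ∀ l, eval (x l) f = if l = j then 1 else 0)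
    (y : Fin d → ℝ) (hy : ∀ j, x j ≠ y) :
    ∃ f : MvPolynomial (Fin d) ℝ, f.totalDegree ≤ m + 1 ∧ (∀ j, eval (x j) f = 0) ∧
      eval y f ≠ 0 := by
  choose ℓ hℓdeg hℓ using hx
  by_cases h : ∃ j, eval y (ℓ j) ≠ 0
  · obtain ⟨j, hj⟩ := h
    obtain ⟨i, hi⟩ := Function.ne_iff.1 (hy j)
    refine ⟨ℓ j * (X i - C (x j i)), ?_, fun l => ?_, ?_⟩
    · refine (totalDegree_mul _ _).trans (add_le_add (hℓdeg j) ?_)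
      exact (totalDegree_sub_C_le _ _).trans (totalDegree_X _).le
    · rcases eq_or_ne l j with rfl | hlj
      · simp
      · simp [hℓ, hlj]
    · simpa [hj, sub_eq_zero] using hi.symm
  · push Not at h
    refine ⟨1 - ∑ j, ℓ j, ?_, fun l => ?_, ?_⟩
    · refine (totalDegree_sub _ _).trans (max_le (by simp) ?_)
      exact totalDegree_finsetSum_le fun j _ => (hℓdeg j).trans (Nat.le_succ m)
    · simp [hℓ]
    · simp [h]

/-- The coordinates of the degree-`n` tensor-power embedding of the sphere, rescaled to unit
length: weighted monomials of degree at most `n`, homogenized by the index `none`. -/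
noncomputable def monomialFeature (d n : ℕ)
    (k : {k // k ∈ Finset.piAntidiag (Finset.univ : Finset (Option (Fin d))) n}) :
    MvPolynomial (Fin d) ℝ :=
  MvPolynomial.C (√((Nat.multinomial Finset.univ k.1 : ℝ) / 2 ^ n)) *
    ∏ i, MvPolynomial.X i ^ k.1 (some i)

/-- The point of Euclidean space with coordinates `monomialFeature d n`. -/
noncomputable def featureMap (d n : ℕ) (y : Fin d → ℝ) : EuclideanSpace ℝ
    {k // k ∈ Finset.piAntidiag (Finset.univ : Finset (Option (Fin d))) n} :=
  WithLp.toLp 2 fun k => MvPolynomial.eval y (monomialFeature d n k)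

open MvPolynomial in
lemma totalDegree_monomialFeature_le {d n : ℕ}
    (k : {k // k ∈ Finset.piAntidiag (Finset.univ : Finset (Option (Fin d))) n}) :
    (monomialFeature d n k).totalDegree ≤ n := by
  refine (totalDegree_mul _ _).trans ?_
  rw [totalDegree_C, zero_add]
  refine (totalDegree_finsetProd _ _).trans ?_
  simp only [totalDegree_X_pow]
  have h := (Finset.mem_piAntidiag.1 k.2).1
  rw [Fintype.sum_option] at h
  omega

lemma norm_featureMap {d : ℕ} (n : ℕ) {y : Fin d → ℝ} (hy : ∑ i, y i ^ 2 = 1) :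
    ‖featureMap d n y‖ = 1 := by
  rw [← sq_eq_sq₀ (norm_nonneg _) zero_le_one, EuclideanSpace.norm_sq_eq]
  have hterm : ∀ k : {k // k ∈ Finset.piAntidiag (Finset.univ : Finset (Option (Fin d))) n},
      ‖featureMap d n y k‖ ^ 2 = (Nat.multinomial Finset.univ k.1 : ℝ) *
        (∏ i, (i.elim 1 (fun j => y j ^ 2) : ℝ) ^ k.1 i) / 2 ^ n := by
    intro k
    simp only [featureMap, monomialFeature, map_mul, MvPolynomial.eval_C, map_prod, map_pow,
      MvPolynomial.eval_X, Real.norm_eq_abs, sq_abs, mul_pow]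
    rw [Real.sq_sqrt (by positivity), Fintype.prod_option, ← Finset.prod_pow]
    simp only [Option.elim, one_pow, one_mul, ← pow_mul, mul_comm 2]
    ring
  simp only [hterm, ← Finset.sum_div]
  rw [Finset.sum_coe_sort (Finset.piAntidiag (Finset.univ : Finset (Option (Fin d))) n)
    (fun k => (Nat.multinomial Finset.univ k : ℝ) *
        (∏ i, (i.elim 1 (fun j => y j ^ 2) : ℝ) ^ k i)),
    ← Finset.sum_pow_eq_sum_piAntidiag, Fintype.sum_option]
  simp only [Option.elim, hy]
  norm_num

open MvPolynomial in
lemma eval_eq_sum_of_featureMap_eq {d n M : ℕ} {x : Fin M → Fin d → ℝ} {y : Fin d → ℝ}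
    {c : Fin M → ℝ} (h : ∑ j, c j • featureMap d n (x j) = featureMap d n y)
    {f : MvPolynomial (Fin d) ℝ} (hf : f.totalDegree ≤ n) :
    eval y f = ∑ j, c j * eval (x j) f := by
  have hmono : ∀ α ∈ f.support, ∏ i, y i ^ α i = ∑ j, c j * ∏ i, x j i ^ α i := by
    intro α hα
    have hα' : ∑ i, α i ≤ n := by
      have := le_totalDegree hα
      rw [Finsupp.sum_fintype _ _ (fun _ => rfl)] at this
      exact this.trans hf
    obtain ⟨k, hk, hkα⟩ : ∃ k ∈ Finset.piAntidiag (Finset.univ : Finset (Option (Fin d))) n,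
        ∀ i, k (some i) = α i := by
      refine ⟨fun o => o.elim (n - ∑ i, α i) α, ?_, fun i => rfl⟩
      rw [Finset.mem_piAntidiag]
      refine ⟨?_, by simp⟩
      rw [Fintype.sum_option]
      simp only [Option.elim]
      omega
    have h1 := congrArg (fun v => v.ofLp ⟨k, hk⟩) h
    simp only [featureMap, monomialFeature, WithLp.ofLp_sum, WithLp.ofLp_smul, Finset.sum_apply,
      Pi.smul_apply, smul_eq_mul, map_mul, eval_C, map_prod, map_pow, eval_X, hkα] at h1
    have hw : √((Nat.multinomial Finset.univ k : ℝ) / 2 ^ n) ≠ 0 := by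
      have : 0 < Nat.multinomial Finset.univ k := Nat.multinomial_pos _ _
      positivity
    refine mul_left_cancel₀ hw (h1.symm.trans ?_)
    rw [Finset.mul_sum]
    refine Finset.sum_congr rfl fun j _ => ?_
    ring
  simp only [eval_eq', Finset.mul_sum]
  rw [Finset.sum_comm]
  refine Finset.sum_congr rfl fun α hα => ?_
  rw [hmono α hα, Finset.mul_sum]
  refine Finset.sum_congr rfl fun j _ => ?_
  ring

open MvPolynomial in
lemma exists_sum_sq_certificate {d n M : ℕ} (x : Fin M → Fin d → ℝ)
    (hx : ∀ y : Fin d → ℝ, (∑ i, y i ^ 2 = 1) → (∀ j, x j ≠ y) →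
      ∃ f : MvPolynomial (Fin d) ℝ, f.totalDegree ≤ n ∧ (∀ j, eval (x j) f = 0) ∧
        eval y f ≠ 0) :
    ∃ g : Fin M → MvPolynomial (Fin d) ℝ, (∀ r, (g r).totalDegree ≤ n) ∧
      ∀ y : Fin d → ℝ, (∑ i, y i ^ 2 = 1) →
        ∑ r, (eval y (g r)) ^ 2 ≤ 1 ∧ (∑ r, (eval y (g r)) ^ 2 = 1 ↔ ∃ j, x j = y) := by
  set V := Submodule.span ℝ (Set.range fun j => featureMap d n (x j))
  have hcard : Module.finrank ℝ V ≤ M :=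
    (finrank_range_le_card (R := ℝ) fun j => featureMap d n (x j)).trans_eq (Fintype.card_fin M)
  let b := stdOrthonormalBasis ℝ V
  let e : Fin (Module.finrank ℝ V) → Fin M := Fin.castLE hcard
  have he : Function.Injective e := Fin.castLE_injective hcard
  let G : Fin (Module.finrank ℝ V) → MvPolynomial (Fin d) ℝ := fun i =>
    ∑ k, C ((b i : EuclideanSpace ℝ _) k) * monomialFeature d n k
  have hGdeg : ∀ i, (G i).totalDegree ≤ n := fun i => totalDegree_finsetSum_le fun k _ => by
    refine (totalDegree_mul _ _).trans ?_
    rw [totalDegree_C, zero_add]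
    exact totalDegree_monomialFeature_le k
  have hG : ∀ y i, eval y (G i) = inner ℝ (b i) (V.orthogonalProjectionOnto (featureMap d n y)) := by
    intro y i
    rw [Submodule.inner_orthogonalProjectionOnto_eq_of_mem_left]
    simp [G, featureMap, PiLp.inner_apply, mul_comm]
  have hsum : ∀ y, ∑ r, (eval y (Function.extend e G 0 r)) ^ 2
      = ‖V.starProjection (featureMap d n y)‖ ^ 2 := by
    intro y
    rw [← Fintype.sum_of_injective e he (fun i => (eval y (G i)) ^ 2)
      (fun r => (eval y (Function.extend e G 0 r)) ^ 2)]
    · simp only [hG, b.sum_sq_inner_right]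
      rfl
    · intro r hr
      have : ¬ ∃ i, e i = r := hr
      simp [Function.extend_apply' _ _ _ this]
    · intro i
      rw [he.extend_apply]
  refine ⟨Function.extend e G 0, fun r => ?_, fun y hy => ?_⟩
  · by_cases hr : ∃ i, e i = r
    · obtain ⟨i, rfl⟩ := hr
      rw [he.extend_apply]
      exact hGdeg i
    · simp [Function.extend_apply' _ _ _ hr]
  · have hnorm := norm_featureMap n hy
    rw [hsum]
    refine ⟨pow_le_one₀ (norm_nonneg _) (hnorm ▸ V.norm_starProjection_apply_le _), ?_⟩
    rw [pow_eq_one_iff_of_nonneg (norm_nonneg _) two_ne_zero, ← hnorm,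
      ← Submodule.mem_iff_norm_starProjection]
    constructor
    · intro hmem
      by_contra! hne
      obtain ⟨f, hfdeg, hf0, hfy⟩ := hx y hy hne
      obtain ⟨c, hc⟩ := (Submodule.mem_span_range_iff_exists_fun ℝ).1 hmem
      exact hfy (by simp [eval_eq_sum_of_featureMap_eq hc hfdeg, hf0])
    · rintro ⟨j, rfl⟩
      exact Submodule.subset_span ⟨j, rfl⟩

lemma certConst_pos {d n : ℕ} (hd : 0 < d) :
    0 < certConst d (Module.finrank ℝ (spherePolySpace d n)) := by
  have hd' : (0 : ℝ) < d := by exact_mod_cast hd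
  have hfin : Module.Finite ℝ (MvPolynomial.restrictTotalDegree (Fin d) ℝ n) :=
    inferInstance
  have : Module.Finite ℝ (spherePolySpace d n) := by
    unfold spherePolySpace
    infer_instance
  have hone : (fun _ => 1) ∈ spherePolySpace d n := by
    refine ⟨1, ?_, ?_⟩
    · simp [MvPolynomial.mem_restrictTotalDegree]
    · ext y
      simp
  have : Nontrivial (spherePolySpace d n) := by
    refine ⟨⟨⟨_, hone⟩, 0, fun h => ?_⟩⟩
    have h1 := congrFun (congrArg Subtype.val h) ⟨Pi.single ⟨0, hd⟩ 1, by
      simp [Pi.single_apply]⟩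
    simp at h1
  have hN : 0 < Module.finrank ℝ (spherePolySpace d n) := Module.finrank_pos
  have hΓ := Real.Gamma_pos_of_pos (half_pos hd')
  unfold certConst
  positivity

/-- **Corollary 3.16 (dual certificate on the sphere).** Let `d, n, M ∈ ℕ`, let
`Ω = {x_1,…,x_M} ⊂ S^{d−1}` be `q`-separated and `n > 2.5 π d / q + 1`. With `N` the
dimension of the space of restrictions to `S^{d−1}` of polynomials of total degree at
most `n`, there are polynomials `p_1,…,p_M` of degree at most `n` such that
`p(x) = (2 π^{d/2} / (Γ(d/2) N)) ∑_{r=1}^M p_r(x)²` is the restriction to the sphere of a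
polynomial of degree at most `2n`, satisfies `0 ≤ p ≤ 1` on the sphere, and `p(x) = 1`
if and only if `x ∈ Ω`. -/
theorem dual_certificate_on_sphere
    {d n M : ℕ} (hd : 0 < d) (hn : 0 < n) (hM : 0 < M)
    (x : Fin M → Fin d → ℝ) (hsph : ∀ j, ∑ i, x j i ^ 2 = 1)
    (hdist : Function.Injective x)
    (q : ℝ) (hq : 0 < q)
    (hsep : ∀ j ℓ, j ≠ ℓ → q < Real.arccos (∑ i, x j i * x ℓ i))
    (hnq : 2.5 * Real.pi * d / q + 1 < n) :
    ∃ g : Fin M → MvPolynomial (Fin d) ℝ,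
      (∀ r, (g r).totalDegree ≤ n) ∧
      (∃ P : MvPolynomial (Fin d) ℝ, P.totalDegree ≤ 2 * n ∧
        ∀ y : Fin d → ℝ, (∑ i, y i ^ 2 = 1) →
          MvPolynomial.eval y P =
            certConst d (Module.finrank ℝ (spherePolySpace d n)) *
              ∑ r, (MvPolynomial.eval y (g r)) ^ 2) ∧
      ∀ y : Fin d → ℝ, (∑ i, y i ^ 2 = 1) →
        (0 ≤ certConst d (Module.finrank ℝ (spherePolySpace d n)) *
            ∑ r, (MvPolynomial.eval y (g r)) ^ 2 ∧
          certConst d (Module.finrank ℝ (spherePolySpace d n)) *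
            ∑ r, (MvPolynomial.eval y (g r)) ^ 2 ≤ 1) ∧
        (certConst d (Module.finrank ℝ (spherePolySpace d n)) *
            ∑ r, (MvPolynomial.eval y (g r)) ^ 2 = 1 ↔ ∃ j, x j = y) := by
  obtain ⟨m, rfl⟩ : ∃ m, n = m + 1 := ⟨n - 1, by omega⟩
  have hmq : 2.5 * Real.pi * d / q < m := by
    push_cast at hnq
    linarith
  obtain ⟨g, hgdeg, hg⟩ := exists_sum_sq_certificate (n := m + 1) x fun y _ hne =>
    exists_vanishing_of_lagrange x (exists_lagrange_of_separated hd x hsph hq hsep hmq) y hne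
  set c := certConst d (Module.finrank ℝ (spherePolySpace d (m + 1)))
  have hc0 : 0 < c := certConst_pos hd
  have hdeg : ∀ r, (MvPolynomial.C (√c)⁻¹ * g r).totalDegree ≤ m + 1 := fun r => by
    refine (MvPolynomial.totalDegree_mul _ _).trans ?_
    rw [MvPolynomial.totalDegree_C, zero_add]
    exact hgdeg r
  have hsum : ∀ y, c * ∑ r, (MvPolynomial.eval y (MvPolynomial.C (√c)⁻¹ * g r)) ^ 2
      = ∑ r, (MvPolynomial.eval y (g r)) ^ 2 := fun y => by
    simp only [map_mul, MvPolynomial.eval_C, mul_pow, ← Finset.mul_sum, inv_pow,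
      Real.sq_sqrt hc0.le]
    rw [mul_inv_cancel_left₀ hc0.ne']
  refine ⟨fun r => MvPolynomial.C (√c)⁻¹ * g r, hdeg, ⟨∑ r, g r ^ 2, ?_, fun y _ => ?_⟩,
    fun y hy => ?_⟩
  · refine MvPolynomial.totalDegree_finsetSum_le fun r _ => ?_
    exact (MvPolynomial.totalDegree_pow _ _).trans (Nat.mul_le_mul_left 2 (hgdeg r))
  · rw [hsum]
    simp
  · rw [hsum]
    exact ⟨⟨Finset.sum_nonneg fun r _ => sq_nonneg _, (hg y hy).1⟩, (hg y hy).2⟩
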